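/- Let n ≥ 3 be an integer. The bubble U₁ attains equality in the sharp half-space Sobolev inequality: (∫_{ℝⁿ₊} U₁^{2*} dx)^{2/2*} = 2^{2/n} S ∫_{ℝⁿ₊} |∇U₁|² dx. In particular the constant 2^{2/n} S in the half-space Sobolev inequality cannot be replaced by any smaller constant. -/

import Mathlib

open MeasureTheory Real

/-- The sharp constant `S = (π n(n−2))⁻¹ (Γ(n)/Γ(n/2))^{2/n}` in the Sobolev
inequality on `ℝⁿ`. -/
noncomputable def sobolevS (n : ℕ) : ℝ :=
  (π * n * ((n : ℝ) - 2))⁻¹ * (Real.Gamma n / Real.Gamma ((n : ℝ) / 2)) ^ ((2 : ℝ) / n)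

/-- The constant `c(n) = 1/(2^{2/n}(n−2) n S)`. -/
noncomputable def bubbleC (n : ℕ) : ℝ :=
  1 / (2 ^ ((2 : ℝ) / n) * ((n : ℝ) - 2) * n * sobolevS n)

/-- The bubble `U_{x₀,λ}(x) = (λ/(λ² + c(n)|x−x₀|²))^{(n−2)/2}`. -/
noncomputable def bubble (n : ℕ) (x₀ : EuclideanSpace ℝ (Fin n)) (lam : ℝ)
    (x : EuclideanSpace ℝ (Fin n)) : ℝ :=
  (lam / (lam ^ 2 + bubbleC n * ‖x - x₀‖ ^ 2)) ^ (((n : ℝ) - 2) / 2)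

/-- The last coordinate `xₙ` of a point of `ℝⁿ`. -/
noncomputable def xlast (n : ℕ) (x : EuclideanSpace ℝ (Fin n)) : ℝ :=
  if h : n = 0 then 0 else x ⟨n - 1, by omega⟩

/-- The open upper half-space `ℝⁿ₊ = {x : xₙ > 0}`. -/
def upperHalf (n : ℕ) : Set (EuclideanSpace ℝ (Fin n)) := {x | 0 < xlast n x}

open Set in
/-- The real Beta integral over `(0, 1)`. -/
lemma integral_Ioo_rpow_mul_one_sub_rpow {a b : ℝ} (ha : 0 < a) (hb : 0 < b) :
    ∫ t in Ioo (0 : ℝ) 1, t ^ (a - 1) * (1 - t) ^ (b - 1) = ProbabilityTheory.beta a b := by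
  have hB := ProbabilityTheory.beta_pos ha hb
  have h1 := ProbabilityTheory.lintegral_betaPDF_eq_one ha hb
  rw [ProbabilityTheory.lintegral_betaPDF] at h1
  have h2 : ∫ t in Ioo (0 : ℝ) 1, 1 / ProbabilityTheory.beta a b * t ^ (a - 1) *
      (1 - t) ^ (b - 1) = 1 := by
    rw [integral_eq_lintegral_of_nonneg_ae, h1, ENNReal.toReal_one]
    · filter_upwards [ae_restrict_mem measurableSet_Ioo] with t ht
      have := ht.1
      have : 0 < 1 - t := by linarith [ht.2]
      simp only [Pi.zero_apply]
      positivity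
    · exact Measurable.aestronglyMeasurable (by fun_prop)
  simp_rw [mul_assoc] at h2
  rw [integral_const_mul] at h2
  field_simp at h2
  exact h2

open Set in
/-- The Beta integral over `(0, ∞)` after the substitution `t = c r² / (1 + c r²)`. -/
lemma integral_Ioi_rpow_mul_one_add_mul_sq_rpow {a b c : ℝ} (ha : 0 < a) (hb : 0 < b)
    (hc : 0 < c) :
    ∫ r in Ioi (0 : ℝ), r ^ (2 * a - 1) * (1 + c * r ^ 2) ^ (-(a + b)) =
      c ^ (-a) / 2 * ProbabilityTheory.beta a b := by
  have hpos (r : ℝ) : 0 < 1 + c * r ^ 2 := by positivity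
  have himg : (fun r : ℝ ↦ c * r ^ 2 / (1 + c * r ^ 2)) '' Ioi 0 = Ioo 0 1 := by
    ext t
    simp only [mem_image, mem_Ioi, mem_Ioo]
    constructor
    · rintro ⟨r, hr, rfl⟩
      refine ⟨by positivity, ?_⟩
      rw [div_lt_one (hpos r)]
      linarith
    · rintro ⟨h0, h1⟩
      have h1' : 0 < 1 - t := by linarith
      refine ⟨√(t / ((1 - t) * c)), by positivity, ?_⟩
      rw [Real.sq_sqrt (by positivity)]
      field_simp
      ring
  have hinj : InjOn (fun r : ℝ ↦ c * r ^ 2 / (1 + c * r ^ 2)) (Ioi 0) := by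
    intro r hr s hs h
    simp only [mem_Ioi] at hr hs
    have hr' := hpos r
    have hs' := hpos s
    simp only at h
    rw [div_eq_div_iff hr'.ne' hs'.ne'] at h
    have : c * (r ^ 2 - s ^ 2) = 0 := by linarith
    have : r ^ 2 = s ^ 2 := by
      rcases mul_eq_zero.1 this with h | h <;> linarith
    exact (pow_left_inj₀ hr.le hs.le two_ne_zero).1 this
  have hder (r : ℝ) : HasDerivAt (fun r : ℝ ↦ c * r ^ 2 / (1 + c * r ^ 2))
      (2 * c * r / (1 + c * r ^ 2) ^ 2) r := by
    have h1 : HasDerivAt (fun r : ℝ ↦ c * r ^ 2) (c * (2 * r)) r := by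
      simpa using (hasDerivAt_pow 2 r).const_mul c
    refine (h1.div (h1.const_add 1) (hpos r).ne').congr_deriv ?_
    ring
  have key := integral_image_eq_integral_abs_deriv_smul measurableSet_Ioi
    (fun r _ ↦ (hder r).hasDerivWithinAt) hinj (fun t ↦ t ^ (a - 1) * (1 - t) ^ (b - 1))
  rw [himg, integral_Ioo_rpow_mul_one_sub_rpow ha hb] at key
  rw [key, ← integral_const_mul]
  refine setIntegral_congr_fun measurableSet_Ioi fun r hr ↦ ?_
  simp only [mem_Ioi] at hr
  have hp := hpos r
  have e1 : 1 - c * r ^ 2 / (1 + c * r ^ 2) = (1 + c * r ^ 2)⁻¹ := by field_simp; ring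
  have e2 : r ^ (2 * a - 1) = (r ^ 2) ^ (a - 1) * r := by
    rw [← Real.rpow_natCast r 2, ← Real.rpow_mul hr.le, ← Real.rpow_add_one hr.ne']
    congr 1; push_cast; ring
  have e3 : (1 + c * r ^ 2) ^ (-(a + b)) =
      ((1 + c * r ^ 2) ^ (a - 1))⁻¹ * ((1 + c * r ^ 2) ^ (b - 1))⁻¹ * ((1 + c * r ^ 2) ^ 2)⁻¹ := by
    rw [← Real.rpow_natCast (1 + c * r ^ 2) 2, ← Real.rpow_neg hp.le, ← Real.rpow_neg hp.le,
      ← Real.rpow_neg hp.le, ← Real.rpow_add hp, ← Real.rpow_add hp]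
    congr 1; push_cast; ring
  have e4 : c ^ (-a) * (c ^ (a - 1) * c) = 1 := by
    rw [← Real.rpow_add_one hc.ne', ← Real.rpow_add hc]; simp
  simp only [smul_eq_mul]
  rw [abs_of_pos (by positivity), e1, e2, e3, Real.div_rpow (by positivity) hp.le,
    Real.mul_rpow hc.le (by positivity), Real.inv_rpow hp.le]
  linear_combination (-(r ^ 2) ^ (a - 1) * r * ((1 + c * r ^ 2) ^ (a - 1))⁻¹ *
    ((1 + c * r ^ 2) ^ (b - 1))⁻¹ * ((1 + c * r ^ 2) ^ 2)⁻¹) * e4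

lemma integral_norm_pow_mul_one_add_mul_sq_rpow {n k : ℕ} (hk : 2 * k < n) {c : ℝ} (hc : 0 < c) :
    ∫ x : EuclideanSpace ℝ (Fin n), ‖x‖ ^ (2 * k) * (1 + c * ‖x‖ ^ 2) ^ (-(n : ℝ)) =
      π ^ ((n : ℝ) / 2) / Gamma ((n : ℝ) / 2) * c ^ (-((n : ℝ) / 2 + k)) *
        ProbabilityTheory.beta ((n : ℝ) / 2 + k) ((n : ℝ) / 2 - k) := by
  have hn : 0 < n := by omega
  have : Nonempty (Fin n) := ⟨⟨0, hn⟩⟩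
  have hk' : (2 : ℝ) * k < n := by exact_mod_cast hk
  have hn' : (0 : ℝ) < n := by exact_mod_cast hn
  have hG : 0 < Gamma ((n : ℝ) / 2) := Real.Gamma_pos_of_pos (by positivity)
  rw [integral_fun_norm_addHaar (μ := volume)
    (fun r : ℝ ↦ r ^ (2 * k) * (1 + c * r ^ 2) ^ (-(n : ℝ)))]
  have h1 : ∫ y in Set.Ioi (0 : ℝ), y ^ (Module.finrank ℝ (EuclideanSpace ℝ (Fin n)) - 1) •
      (y ^ (2 * k) * (1 + c * y ^ 2) ^ (-(n : ℝ))) =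
      c ^ (-((n : ℝ) / 2 + k)) / 2 *
        ProbabilityTheory.beta ((n : ℝ) / 2 + k) ((n : ℝ) / 2 - k) := by
    rw [← integral_Ioi_rpow_mul_one_add_mul_sq_rpow (by positivity) (by linarith) hc]
    refine setIntegral_congr_fun measurableSet_Ioi fun r hr ↦ ?_
    simp only [finrank_euclideanSpace, Fintype.card_fin, smul_eq_mul]
    rw [← mul_assoc, ← pow_add, ← Real.rpow_natCast]
    congr 2
    · push_cast [Nat.cast_sub (show 1 ≤ n from hn)]; ring
    · ring
  rw [h1, Measure.real, EuclideanSpace.volume_ball]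
  simp only [finrank_euclideanSpace, Fintype.card_fin, ENNReal.ofReal_one, one_pow, one_mul,
    nsmul_eq_mul, smul_eq_mul]
  rw [ENNReal.toReal_ofReal (by positivity), Real.Gamma_add_one (by positivity),
    Real.sqrt_eq_rpow, ← Real.rpow_natCast, ← Real.rpow_mul pi_pos.le]
  rw [show 1 / 2 * (n : ℝ) = n / 2 by ring]
  field_simp

lemma measurable_xlast (n : ℕ) : Measurable (xlast n) := by
  unfold xlast
  split_ifs <;> fun_prop

lemma xlast_neg (n : ℕ) (x : EuclideanSpace ℝ (Fin n)) : xlast n (-x) = -xlast n x := by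
  unfold xlast
  split_ifs <;> simp

lemma volume_xlast_eq_zero {n : ℕ} (hn : n ≠ 0) :
    volume {x : EuclideanSpace ℝ (Fin n) | xlast n x = 0} = 0 := by
  let p : EuclideanSpace ℝ (Fin n) →L[ℝ] ℝ := EuclideanSpace.proj ⟨n - 1, by omega⟩
  have hp : {x : EuclideanSpace ℝ (Fin n) | xlast n x = 0} =
      (LinearMap.ker p.toLinearMap : Set _) := by
    ext x
    simp [xlast, hn, p]
  rw [hp]
  refine Measure.addHaar_submodule _ _ fun h ↦ ?_
  have : EuclideanSpace.single (⟨n - 1, by omega⟩ : Fin n) (1 : ℝ) ∈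
      LinearMap.ker p.toLinearMap := by rw [h]; trivial
  simp [p] at this

/-- An even integrable function has half of its integral over the upper half-space. -/
lemma setIntegral_upperHalf_of_even {n : ℕ} (hn : n ≠ 0) {f : EuclideanSpace ℝ (Fin n) → ℝ}
    (hf : ∀ x, f (-x) = f x) (hi : Integrable f) :
    ∫ x in upperHalf n, f x = (∫ x, f x) / 2 := by
  have hm : MeasurableSet (upperHalf n) :=
    measurableSet_lt measurable_const (measurable_xlast n)
  have h1 := integral_add_compl hm hi
  have h2 : ∫ x in (upperHalf n)ᶜ, f x = ∫ x in upperHalf n, f x := by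
    have h3 : ((upperHalf n)ᶜ : Set (EuclideanSpace ℝ (Fin n))) =ᵐ[volume]
        (Neg.neg ⁻¹' upperHalf n : Set (EuclideanSpace ℝ (Fin n))) := by
      have h0 : ∀ᵐ x : EuclideanSpace ℝ (Fin n), xlast n x ≠ 0 := by
        rw [ae_iff]; simpa using volume_xlast_eq_zero hn
      filter_upwards [h0] with x hx
      refine propext ⟨fun h ↦ ?_, fun h ↦ ?_⟩
      · have h' : ¬ 0 < xlast n x := h
        change 0 < xlast n (-x)
        rw [xlast_neg]
        have := lt_of_le_of_ne (not_lt.1 h') hx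
        linarith
      · have h' : 0 < xlast n (-x) := h
        rw [xlast_neg] at h'
        change ¬ 0 < xlast n x
        linarith
    rw [setIntegral_congr_set h3]
    have := (Measure.measurePreserving_neg
      (volume : Measure (EuclideanSpace ℝ (Fin n)))).setIntegral_preimage_emb
      (MeasurableEquiv.neg _).measurableEmbedding f (upperHalf n)
    simpa [hf] using this
  linarith

lemma setIntegral_upperHalf_norm_pow_mul {n k : ℕ} (hk : 2 * k < n) {c : ℝ} (hc : 0 < c) :
    ∫ x in upperHalf n, ‖x‖ ^ (2 * k) * (1 + c * ‖x‖ ^ 2) ^ (-(n : ℝ)) =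
      π ^ ((n : ℝ) / 2) / Gamma ((n : ℝ) / 2) * c ^ (-((n : ℝ) / 2 + k)) *
        ProbabilityTheory.beta ((n : ℝ) / 2 + k) ((n : ℝ) / 2 - k) / 2 := by
  have hk' : (2 : ℝ) * k < n := by exact_mod_cast hk
  have hn' : (0 : ℝ) < n := by exact_mod_cast (show 0 < n by omega)
  have h := integral_norm_pow_mul_one_add_mul_sq_rpow hk hc
  have hG : 0 < Gamma ((n : ℝ) / 2) := Real.Gamma_pos_of_pos (by positivity)
  have hB : 0 < ProbabilityTheory.beta ((n : ℝ) / 2 + k) ((n : ℝ) / 2 - k) :=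
    ProbabilityTheory.beta_pos (by positivity) (by linarith)
  rw [setIntegral_upperHalf_of_even (by omega) (by simp), h]
  refine not_imp_comm.1 integral_undef ?_
  rw [h]
  positivity

lemma sobolevS_pos {n : ℕ} (hn : 3 ≤ n) : 0 < sobolevS n := by
  have hn' : (3 : ℝ) ≤ n := by exact_mod_cast hn
  have : 0 < (n : ℝ) - 2 := by linarith
  have hG : 0 < Gamma ((n : ℝ) / 2) := Real.Gamma_pos_of_pos (by positivity)
  have hG' : 0 < Gamma (n : ℝ) := Real.Gamma_pos_of_pos (by positivity)
  unfold sobolevS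
  positivity

lemma bubbleC_pos {n : ℕ} (hn : 3 ≤ n) : 0 < bubbleC n := by
  have hn' : (3 : ℝ) ≤ n := by exact_mod_cast hn
  have : 0 < (n : ℝ) - 2 := by linarith
  have := sobolevS_pos hn
  unfold bubbleC
  positivity

lemma bubbleC_rpow_half {n : ℕ} (hn : 3 ≤ n) :
    bubbleC n ^ ((n : ℝ) / 2) = π ^ ((n : ℝ) / 2) * Gamma ((n : ℝ) / 2) / Gamma n / 2 := by
  have hn' : (3 : ℝ) ≤ n := by exact_mod_cast hn
  have h0 : 0 < (n : ℝ) := by linarith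
  have h2 : 0 < (n : ℝ) - 2 := by linarith
  have hG : 0 < Gamma ((n : ℝ) / 2) := Real.Gamma_pos_of_pos (by positivity)
  have hG' : 0 < Gamma (n : ℝ) := Real.Gamma_pos_of_pos (by positivity)
  have e : bubbleC n =
      π / (2 ^ ((2 : ℝ) / n) * (Gamma n / Gamma ((n : ℝ) / 2)) ^ ((2 : ℝ) / n)) := by
    unfold bubbleC sobolevS
    field_simp
  have e1 : (2 : ℝ) / n * (n / 2) = 1 := by field_simp
  rw [e, Real.div_rpow pi_pos.le (by positivity), Real.mul_rpow (by positivity) (by positivity),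
    ← Real.rpow_mul (by positivity), ← Real.rpow_mul (by positivity), e1, Real.rpow_one,
    Real.rpow_one]
  field_simp

lemma bubble_zero_one (n : ℕ) (hc : 0 ≤ bubbleC n) (x : EuclideanSpace ℝ (Fin n)) :
    bubble n 0 1 x = (1 + bubbleC n * ‖x‖ ^ 2) ^ (-(((n : ℝ) - 2) / 2)) := by
  unfold bubble
  rw [sub_zero, one_pow, one_div, Real.inv_rpow (by positivity), Real.rpow_neg (by positivity)]

lemma bubble_zero_one_rpow {n : ℕ} (hn : 3 ≤ n) (x : EuclideanSpace ℝ (Fin n)) :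
    bubble n 0 1 x ^ (2 * (n : ℝ) / ((n : ℝ) - 2)) =
      (1 + bubbleC n * ‖x‖ ^ 2) ^ (-(n : ℝ)) := by
  have hn' : (3 : ℝ) ≤ n := by exact_mod_cast hn
  have h2 : (n : ℝ) - 2 ≠ 0 := by linarith
  have hc := bubbleC_pos hn
  rw [bubble_zero_one n hc.le, ← Real.rpow_mul (by positivity)]
  congr 1
  field_simp

lemma norm_gradient_bubble_sq {n : ℕ} (hn : 3 ≤ n) (x : EuclideanSpace ℝ (Fin n)) :
    ‖gradient (bubble n 0 1) x‖ ^ 2 = (((n : ℝ) - 2) * bubbleC n) ^ 2 *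
      (‖x‖ ^ (2 * 1) * (1 + bubbleC n * ‖x‖ ^ 2) ^ (-(n : ℝ))) := by
  have hc := bubbleC_pos hn
  have hp : 0 < 1 + bubbleC n * ‖x‖ ^ 2 := by positivity
  have h1 : HasFDerivAt (fun x : EuclideanSpace ℝ (Fin n) ↦ 1 + bubbleC n * ‖x‖ ^ 2)
      (bubbleC n • (2 • innerSL ℝ x)) x :=
    ((hasStrictFDerivAt_norm_sq x).hasFDerivAt.const_mul (bubbleC n)).const_add 1
  have h2 := h1.rpow_const (p := -(((n : ℝ) - 2) / 2)) (Or.inl hp.ne')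
  have h3 : HasGradientAt (bubble n 0 1)
      ((-(((n : ℝ) - 2) * bubbleC n) *
        (1 + bubbleC n * ‖x‖ ^ 2) ^ (-((n : ℝ) / 2))) • x) x := by
    rw [hasGradientAt_iff_hasFDerivAt, show bubble n 0 1 = _ from
      funext (bubble_zero_one n hc.le)]
    refine h2.congr_fderiv (ContinuousLinearMap.ext fun y ↦ ?_)
    rw [show -(((n : ℝ) - 2) / 2) - 1 = -((n : ℝ) / 2) by ring]
    simp
    ring
  rw [h3.gradient, norm_smul, mul_pow, Real.norm_eq_abs, sq_abs, mul_pow,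
    ← Real.rpow_natCast ((1 + bubbleC n * ‖x‖ ^ 2) ^ (-((n : ℝ) / 2))) 2,
    ← Real.rpow_mul hp.le, show -((n : ℝ) / 2) * ((2 : ℕ) : ℝ) = -(n : ℝ) by push_cast; ring]
  ring

/-- The bubble `U₁` is normalised in `L^{2*}` of the half-space. -/
lemma setIntegral_upperHalf_bubble_rpow {n : ℕ} (hn : 3 ≤ n) :
    ∫ x in upperHalf n, bubble n 0 1 x ^ (2 * (n : ℝ) / ((n : ℝ) - 2)) = 1 := by
  have hn' : (3 : ℝ) ≤ n := by exact_mod_cast hn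
  have hG : 0 < Gamma ((n : ℝ) / 2) := Real.Gamma_pos_of_pos (by positivity)
  have hG' : 0 < Gamma (n : ℝ) := Real.Gamma_pos_of_pos (by positivity)
  have hc := bubbleC_pos hn
  have h := setIntegral_upperHalf_norm_pow_mul (n := n) (k := 0) (by omega) hc
  simp only [mul_zero, pow_zero, one_mul, Nat.cast_zero, add_zero, sub_zero] at h
  simp_rw [bubble_zero_one_rpow hn]
  rw [h, Real.rpow_neg hc.le, bubbleC_rpow_half hn, ProbabilityTheory.beta, add_halves]
  field_simp

lemma setIntegral_upperHalf_norm_gradient_bubble_sq {n : ℕ} (hn : 3 ≤ n) :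
    ∫ x in upperHalf n, ‖gradient (bubble n 0 1) x‖ ^ 2 = n * ((n : ℝ) - 2) * bubbleC n := by
  have hn' : (3 : ℝ) ≤ n := by exact_mod_cast hn
  have h2 : 0 < (n : ℝ) - 2 := by linarith
  have h2' : (n : ℝ) / 2 - 1 ≠ 0 := by linarith
  have hG : 0 < Gamma ((n : ℝ) / 2) := Real.Gamma_pos_of_pos (by positivity)
  have hG' : 0 < Gamma (n : ℝ) := Real.Gamma_pos_of_pos (by positivity)
  have hc := bubbleC_pos hn
  have h := setIntegral_upperHalf_norm_pow_mul (n := n) (k := 1) (by omega) hc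
  have e : Gamma ((n : ℝ) / 2) = ((n : ℝ) / 2 - 1) * Gamma ((n : ℝ) / 2 - 1) := by
    rw [← Real.Gamma_add_one h2', sub_add_cancel]
  have e' : Gamma ((n : ℝ) / 2 - 1) = 2 * Gamma ((n : ℝ) / 2) / ((n : ℝ) - 2) := by
    rw [e]; field_simp
  simp_rw [norm_gradient_bubble_sq hn]
  rw [integral_const_mul, h, Real.rpow_neg hc.le, Nat.cast_one, Real.rpow_add_one hc.ne',
    bubbleC_rpow_half hn, ProbabilityTheory.beta,
    show (n : ℝ) / 2 + 1 + (n / 2 - 1) = n by ring, Real.Gamma_add_one (by positivity), e']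
  field_simp

/-- the bubble `U₁` attains equality in the sharp half-space
Sobolev inequality `(∫_{ℝⁿ₊} U₁^{2*})^{2/2*} = 2^{2/n} S ∫_{ℝⁿ₊} |∇U₁|²`;
in particular no constant smaller than `2^{2/n} S` can serve in the
half-space Sobolev inequality. -/
theorem bubble_extremal_halfSpace (n : ℕ) (hn : 3 ≤ n) :
    ((∫ x in upperHalf n, bubble n 0 1 x ^ (2 * (n : ℝ) / ((n : ℝ) - 2))) ^
        (((n : ℝ) - 2) / n) =
      2 ^ ((2 : ℝ) / n) * sobolevS n *
        ∫ x in upperHalf n, ‖gradient (bubble n 0 1) x‖ ^ 2) ∧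
    ∀ c' : ℝ,
      ((∫ x in upperHalf n, bubble n 0 1 x ^ (2 * (n : ℝ) / ((n : ℝ) - 2))) ^
          (((n : ℝ) - 2) / n) ≤
        c' * ∫ x in upperHalf n, ‖gradient (bubble n 0 1) x‖ ^ 2) →
      2 ^ ((2 : ℝ) / n) * sobolevS n ≤ c' := by
  have hn' : (3 : ℝ) ≤ n := by exact_mod_cast hn
  have h2 : 0 < (n : ℝ) - 2 := by linarith
  have hS := sobolevS_pos hn
  have key : 2 ^ ((2 : ℝ) / n) * sobolevS n * (n * ((n : ℝ) - 2) * bubbleC n) = 1 := by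
    unfold bubbleC
    field_simp
  have hpos : 0 < n * ((n : ℝ) - 2) * bubbleC n := by
    have := bubbleC_pos hn
    positivity
  rw [setIntegral_upperHalf_bubble_rpow hn, setIntegral_upperHalf_norm_gradient_bubble_sq hn,
    Real.one_rpow]
  refine ⟨key.symm, fun c' hc' ↦ ?_⟩
  rw [← key] at hc'
  exact le_of_mul_le_mul_right hc' hpos
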